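/- Let Φ be a non-uniform random 2-SAT formula on n variables with probability vector p satisfying p₁² = o(Σ_{i=1}^n pᵢ²). Then for every constant ε > 0 and any number of clauses m < (1−ε)·(Σ_{i=1}^n pᵢ²)^{-1}, Φ is satisfiable with probability at least 1 − o(1) as n → ∞. -/

import Mathlib

open Finset Filter Asymptotics

open scoped Classical

/-- The probability of drawing a given ordered 2-clause (an ordered pair of literals over
distinct variables); an unordered 2-clause over variables `i ≠ j` then has total probability
`(C/2)·pᵢ·pⱼ` where `C = (1 - ∑ pᵢ²)⁻¹`. -/
noncomputable def clauseProb2 (n : ℕ) (p : ℕ → ℝ) (c : (Fin n × Bool) × (Fin n × Bool)) : ℝ :=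
  if c.1.1 ≠ c.2.1 then
    (1 - ∑ i ∈ Finset.range n, p i ^ 2)⁻¹ / 4 * p c.1.1.1 * p c.2.1.1
  else 0

/-- The probability of drawing a given formula: `m` clauses drawn independently. -/
noncomputable def formulaProb2 (n m : ℕ) (p : ℕ → ℝ)
    (Φ : Fin m → (Fin n × Bool) × (Fin n × Bool)) : ℝ :=
  ∏ j, clauseProb2 n p (Φ j)

/-- Satisfiability of a 2-CNF formula: a literal `(x, b)` is satisfied by an assignment `a`
iff `a x = b`. -/
def Sat2 {n m : ℕ} (Φ : Fin m → (Fin n × Bool) × (Fin n × Bool)) : Prop :=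
  ∃ a : Fin n → Bool, ∀ j, a (Φ j).1.1 = (Φ j).1.2 ∨ a (Φ j).2.1 = (Φ j).2.2

/-- The probability that a non-uniform random 2-SAT formula with `n` variables, `m` clauses
and variable distribution `p` is satisfiable. -/
noncomputable def probSat2 (n m : ℕ) (p : ℕ → ℝ) : ℝ :=
  ∑ Φ : Fin m → (Fin n × Bool) × (Fin n × Bool),
    if Sat2 Φ then formulaProb2 n m p Φ else 0

/-- The probability that a non-uniform random 2-SAT formula is unsatisfiable. -/
noncomputable def probUnsat2 (n m : ℕ) (p : ℕ → ℝ) : ℝ :=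
  ∑ Φ : Fin m → (Fin n × Bool) × (Fin n × Bool),
    if ¬ Sat2 Φ then formulaProb2 n m p Φ else 0

/-- The normalization constant `C = (1 - ∑ pᵢ²)⁻¹`. -/
noncomputable def Cconst (n : ℕ) (p : ℕ → ℝ) : ℝ :=
  (1 - ∑ i ∈ Finset.range n, p i ^ 2)⁻¹

/-- The maximum clause probability `q_max = (C/2)·p₁·p₂`. -/
noncomputable def qmax2 (n : ℕ) (p : ℕ → ℝ) : ℝ :=
  Cconst n p / 2 * p 0 * p 1

/-- `p n` is a probability vector on `n` variables (indexed `0,…,n-1`), sorted decreasingly,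
with all entries positive. -/
def ProbEnsemble (p : ℕ → ℕ → ℝ) : Prop :=
  ∀ n, 1 ≤ n →
    (∑ i ∈ Finset.range n, p n i = 1) ∧
    (∀ i j, i ≤ j → j < n → p n j ≤ p n i) ∧
    (∀ i, i < n → 0 < p n i)

abbrev Lit2 (n : ℕ) := Fin n × Bool

def lneg {n : ℕ} (l : Lit2 n) : Lit2 n := (l.1, !l.2)

lemma lneg_lneg {n : ℕ} (l : Lit2 n) : lneg (lneg l) = l := by
  simp [lneg]

lemma lneg_ne {n : ℕ} (l : Lit2 n) : lneg l ≠ l := by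
  obtain ⟨a, b⟩ := l
  simp [lneg]

lemma lneg_fst {n : ℕ} (l : Lit2 n) : (lneg l).1 = l.1 := rfl

lemma lit_eq_or {n : ℕ} {x y : Lit2 n} (h : x.1 = y.1) : x = y ∨ x = lneg y := by
  obtain ⟨a, b⟩ := x
  obtain ⟨c, d⟩ := y
  simp only at h
  subst h
  cases b <;> cases d <;> simp [lneg]

def AdjJ {n m : ℕ} (Φ : Fin m → Lit2 n × Lit2 n) (J : Finset (Fin m)) (x y : Lit2 n) : Prop :=
  ∃ j ∈ J, Φ j = (lneg x, y) ∨ Φ j = (y, lneg x)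

def SatOn {n m : ℕ} (Φ : Fin m → Lit2 n × Lit2 n) (J : Finset (Fin m)) : Prop :=
  ∃ a : Fin n → Bool, ∀ j ∈ J, a (Φ j).1.1 = (Φ j).1.2 ∨ a (Φ j).2.1 = (Φ j).2.2

lemma AdjJ.contra {n m : ℕ} {Φ : Fin m → Lit2 n × Lit2 n} {J : Finset (Fin m)} {x y : Lit2 n}
    (h : AdjJ Φ J x y) : AdjJ Φ J (lneg y) (lneg x) := by
  obtain ⟨j, hj, h⟩ := h
  refine ⟨j, hj, ?_⟩
  rw [lneg_lneg]
  exact h.symm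

inductive SPath {n : ℕ} (A : Lit2 n → Lit2 n → Prop) (a : Lit2 n) : List (Lit2 n) → Prop
  | single : SPath A a [a]
  | cons (x y : Lit2 n) (L : List (Lit2 n)) : SPath A a (x :: L) → A x y →
      (∀ z ∈ x :: L, z.1 ≠ y.1) → SPath A a (y :: x :: L)

section paths
variable {n : ℕ} {A : Lit2 n → Lit2 n → Prop} {a : Lit2 n}

lemma SPath.mem_start {L : List (Lit2 n)} (h : SPath A a L) : a ∈ L := by
  induction h with
  | single => simp
  | cons x y L h1 h2 h3 ih => exact List.mem_cons_of_mem _ ih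

lemma SPath.prefix_mem {L : List (Lit2 n)} (h : SPath A a L) :
    ∀ z ∈ L, ∃ L', SPath A a (z :: L') := by
  induction h with
  | single =>
    intro z hz
    rw [List.mem_singleton] at hz
    subst hz
    exact ⟨[], .single⟩
  | cons x y L h1 h2 h3 ih =>
    intro z hz
    rcases List.mem_cons.1 hz with rfl | hz
    · exact ⟨_, .cons x z L h1 h2 h3⟩
    · exact ih z hz

lemma SPath.nodup {L : List (Lit2 n)} (h : SPath A a L) : (L.map Prod.fst).Nodup := by
  induction h with
  | single => simp
  | cons x y L h1 h2 h3 ih =>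
    rw [List.map_cons, List.nodup_cons]
    refine ⟨?_, ih⟩
    intro hm
    obtain ⟨z, hz, hzy⟩ := List.mem_map.1 hm
    exact h3 z hz hzy

lemma SPath.prepend {L : List (Lit2 n)} (h : SPath A a L) {z : Lit2 n} (hz : A z a)
    (hn : ∀ y ∈ L, y.1 ≠ z.1) : SPath A z (L ++ [z]) := by
  induction h with
  | single =>
    refine SPath.cons z a [] .single hz ?_
    intro y hy
    rw [List.mem_singleton] at hy
    subst hy
    exact (hn a (by simp)).symm
  | cons x y L h1 h2 h3 ih =>
    have := ih (fun w hw => hn w (List.mem_cons_of_mem _ hw))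
    refine SPath.cons x y (L ++ [z]) this h2 ?_
    intro w hw
    have hw' : w ∈ x :: L ∨ w = z := by simpa [or_assoc] using hw
    rcases hw' with hw | rfl
    · exact h3 w hw
    · exact (hn y (by simp)).symm

def SReach (A : Lit2 n → Lit2 n → Prop) (a z : Lit2 n) : Prop := ∃ L, SPath A a (z :: L)

def NoLasso (A : Lit2 n → Lit2 n → Prop) : Prop :=
  ∀ a x y L, SPath A a (x :: L) → A x y → lneg y ∉ x :: L

lemma SReach.step (hA : NoLasso A) {x y : Lit2 n} (h : SReach A a x) (hxy : A x y) :
    SReach A a y := by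
  obtain ⟨L, hL⟩ := h
  by_cases hc : ∀ z ∈ x :: L, z.1 ≠ y.1
  · exact ⟨_, .cons x y L hL hxy hc⟩
  · push Not at hc
    obtain ⟨z, hz, hzy⟩ := hc
    rcases lit_eq_or hzy with rfl | rfl
    · exact hL.prefix_mem _ hz
    · exact absurd hz (hA _ _ _ _ hL hxy)

lemma SPath.consistent (hA : NoLasso A) (hs : ∀ x y, A x y → A (lneg y) (lneg x))
    {L : List (Lit2 n)} (h : SPath A a L) : ∀ x L', L = x :: L' → ¬ SReach A a (lneg x) := by
  induction h with
  | single =>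
    rintro x L' he ⟨M, hM⟩
    obtain ⟨rfl, rfl⟩ := List.cons.inj he
    generalize hN : lneg a :: M = N at hM
    cases hM with
    | single => exact lneg_ne a (List.cons.inj hN).1
    | cons x y L h1 h2 h3 =>
      obtain ⟨rfl, rfl⟩ := List.cons.inj hN
      exact h3 a h1.mem_start rfl
  | cons x y L h1 h2 h3 ih =>
    rintro x' L' he hr
    obtain ⟨rfl, rfl⟩ := List.cons.inj he
    exact ih x L rfl (hr.step hA (hs _ _ h2))

lemma SPath.toFun {L : List (Lit2 n)} (h : SPath A a L) : ∀ x L', L = x :: L' →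
    ∃ (k : ℕ) (w : ℕ → Lit2 n), w 0 = a ∧ w k = x ∧ (∀ i < k, A (w i) (w (i + 1))) ∧
      (∀ i ≤ k, ∀ j ≤ k, (w i).1 = (w j).1 → i = j) ∧ ∀ z, z ∈ L ↔ ∃ i ≤ k, w i = z := by
  induction h with
  | single =>
    rintro x L' he
    obtain ⟨rfl, rfl⟩ := List.cons.inj he
    refine ⟨0, fun _ => a, rfl, rfl, by simp, ?_, ?_⟩
    · intro i hi j hj _
      omega
    · intro z
      simp [eq_comm]
  | cons x y L h1 h2 h3 ih =>
    rintro x' L' he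
    obtain ⟨rfl, rfl⟩ := List.cons.inj he
    obtain ⟨k, w, w0, wk, wA, wi, wm⟩ := ih x L rfl
    have key : ∀ i ≤ k, (w i).1 ≠ y.1 := fun i hi => h3 _ ((wm _).2 ⟨i, hi, rfl⟩)
    refine ⟨k + 1, fun i => if i ≤ k then w i else y, by simp [w0], by simp, ?_, ?_, ?_⟩
    · intro i hi
      by_cases hik : i = k
      · subst hik
        simpa [wk] using h2
      · have h1 : i ≤ k := by omega
        have h2 : i + 1 ≤ k := by omega
        simpa [h1, h2] using wA i (by omega)
    · intro i hi j hj
      by_cases h1 : i ≤ k <;> by_cases h2 : j ≤ k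
      · simpa [h1, h2] using wi i h1 j h2
      · simp only [h1, h2, if_true, if_false]
        intro h
        exact absurd h (key i h1)
      · simp only [h1, h2, if_true, if_false]
        intro h
        exact absurd h.symm (key j h2)
      · intro _
        omega
    · intro z
      rw [List.mem_cons, wm]
      constructor
      · rintro (rfl | ⟨i, hi, rfl⟩)
        · exact ⟨k + 1, le_rfl, by simp⟩
        · exact ⟨i, by omega, by simp [hi]⟩
      · rintro ⟨i, hi, rfl⟩
        by_cases h1 : i ≤ k
        · right
          exact ⟨i, h1, by simp [h1]⟩
        · left
          simp [h1]

end paths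

section minimal
variable {n m : ℕ} {Φ : Fin m → Lit2 n × Lit2 n} {J : Finset (Fin m)}

lemma exists_min_unsat (h : ¬ Sat2 Φ) : ∃ J : Finset (Fin m), ¬ SatOn Φ J ∧
    ∀ j ∈ J, SatOn Φ (J.erase j) := by
  have h0 : ¬ SatOn Φ Finset.univ := by
    rintro ⟨a, ha⟩
    exact h ⟨a, fun j => ha j (Finset.mem_univ j)⟩
  by_contra hc
  push Not at hc
  have : ∀ J : Finset (Fin m), SatOn Φ J := by
    intro J
    induction J using Finset.strongInduction with
    | H J ih =>
      by_contra hJ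
      obtain ⟨j, hj, hj'⟩ := hc J hJ
      exact hj' (ih _ (Finset.erase_ssubset hj))
  exact h0 (this _)

lemma exists_pred (hJ : ¬ SatOn Φ J) (hmin : ∀ j ∈ J, SatOn Φ (J.erase j)) {x y : Lit2 n}
    (h : AdjJ Φ J x y) : ∃ z, AdjJ Φ J z x := by
  obtain ⟨j, hj, hjc⟩ := h
  obtain ⟨α, hα⟩ := hmin j hj
  by_contra hc
  have hno : ∀ i ∈ J, (Φ i).1 ≠ x ∧ (Φ i).2 ≠ x := by
    intro i hi
    constructor
    · intro he
      exact hc ⟨lneg (Φ i).2, i, hi, Or.inr (by rw [lneg_lneg, ← he])⟩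
    · intro he
      exact hc ⟨lneg (Φ i).1, i, hi, Or.inl (by rw [lneg_lneg, ← he])⟩
  apply hJ
  have key : ∀ l : Lit2 n, l ≠ x → α l.1 = l.2 → Function.update α x.1 (!x.2) l.1 = l.2 := by
    intro l hl hal
    by_cases hv : l.1 = x.1
    · rcases lit_eq_or hv with rfl | rfl
      · exact absurd rfl hl
      · simp [lneg]
    · rw [Function.update_of_ne hv, hal]
  refine ⟨Function.update α x.1 (!x.2), ?_⟩
  intro i hi
  by_cases hij : i = j
  · subst hij
    rcases hjc with h | h <;> simp [h, lneg]
  · rcases hα i (Finset.mem_erase.2 ⟨hij, hi⟩) with h | h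
    · exact Or.inl (key _ (hno i hi).1 h)
    · exact Or.inr (key _ (hno i hi).2 h)

lemma exists_lasso (hJ : ¬ SatOn Φ J) (hmin : ∀ j ∈ J, SatOn Φ (J.erase j)) :
    ¬ NoLasso (AdjJ Φ J) := by
  intro hA
  have hne : J.Nonempty := by
    by_contra h
    rw [Finset.not_nonempty_iff_eq_empty] at h
    subst h
    exact hJ ⟨fun _ => true, by simp⟩
  obtain ⟨j, hj⟩ := hne
  obtain ⟨α, hα⟩ := hmin j hj
  set a := (Φ j).1 with ha
  have hcons : ∀ x, SReach (AdjJ Φ J) a x → ¬ SReach (AdjJ Φ J) a (lneg x) := by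
    rintro x ⟨L, hL⟩
    exact hL.consistent hA (fun _ _ h => h.contra) x L rfl
  let β : Fin n → Bool := fun v =>
    if SReach (AdjJ Φ J) a (v, true) then true
    else if SReach (AdjJ Φ J) a (v, false) then false else α v
  have hβ1 : ∀ l, SReach (AdjJ Φ J) a l → β l.1 = l.2 := by
    rintro ⟨v, b⟩ h
    cases b
    · have : ¬ SReach (AdjJ Φ J) a (v, true) := hcons _ h
      simp [β, this, h]
    · simp [β, h]
  have hβ2 : ∀ l, ¬ SReach (AdjJ Φ J) a l → ¬ SReach (AdjJ Φ J) a (lneg l) →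
      β l.1 = α l.1 := by
    rintro ⟨v, b⟩ h h'
    cases b <;> simp only [lneg, Bool.not_true, Bool.not_false] at h' <;> simp [β, h, h']
  apply hJ
  refine ⟨β, ?_⟩
  intro i hi
  by_cases h1 : SReach (AdjJ Φ J) a (Φ i).1
  · exact Or.inl (hβ1 _ h1)
  by_cases h2 : SReach (AdjJ Φ J) a (Φ i).2
  · exact Or.inr (hβ1 _ h2)
  have h3 : ¬ SReach (AdjJ Φ J) a (lneg (Φ i).1) := fun h =>
    h2 (h.step hA ⟨i, hi, Or.inl (by rw [lneg_lneg])⟩)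
  have h4 : ¬ SReach (AdjJ Φ J) a (lneg (Φ i).2) := fun h =>
    h1 (h.step hA ⟨i, hi, Or.inr (by rw [lneg_lneg])⟩)
  rw [hβ2 _ h1 h3, hβ2 _ h2 h4]
  apply hα i
  refine Finset.mem_erase.2 ⟨?_, hi⟩
  rintro rfl
  exact h1 ⟨[], .single⟩

lemma exists_bicycle_aux (hJ : ¬ SatOn Φ J) (hmin : ∀ j ∈ J, SatOn Φ (J.erase j)) :
    ∃ a x v u L, SPath (AdjJ Φ J) a (x :: L) ∧ AdjJ Φ J x v ∧ lneg v ∈ x :: L ∧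
      AdjJ Φ J u a ∧ ∃ z ∈ x :: L, z.1 = u.1 := by
  by_contra hc
  have hc' : ∀ a x v u L, SPath (AdjJ Φ J) a (x :: L) → AdjJ Φ J x v → lneg v ∈ x :: L →
      AdjJ Φ J u a → ∀ z ∈ x :: L, z.1 ≠ u.1 := by
    intro a x v u L h1 h2 h3 h4 z hz hzu
    exact hc ⟨a, x, v, u, L, h1, h2, h3, h4, z, hz, hzu⟩
  have hl := exists_lasso hJ hmin
  simp only [NoLasso] at hl
  push Not at hl
  have all : ∀ N : ℕ, ∃ a x v L, SPath (AdjJ Φ J) a (x :: L) ∧ AdjJ Φ J x v ∧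
      lneg v ∈ x :: L ∧ N ≤ (x :: L).length := by
    intro N
    induction N with
    | zero =>
      obtain ⟨a, x, v, L, h1, h2, h3⟩ := hl
      exact ⟨a, x, v, L, h1, h2, h3, Nat.zero_le _⟩
    | succ N ih =>
      obtain ⟨a, x, v, L, h1, h2, h3, h4⟩ := ih
      have hout : ∃ y, AdjJ Φ J a y := by
        obtain ⟨k, w, w0, wk, wA, wi, wm⟩ := h1.toFun x L rfl
        rcases Nat.eq_zero_or_pos k with rfl | hk
        · exact ⟨v, by rw [← w0, wk]; exact h2⟩
        · exact ⟨w 1, by rw [← w0]; exact wA 0 hk⟩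
      obtain ⟨y, hy⟩ := hout
      obtain ⟨u, hu⟩ := exists_pred hJ hmin hy
      refine ⟨u, x, v, L ++ [u], h1.prepend hu (hc' a x v u L h1 h2 h3 hu), h2, ?_, ?_⟩
      · rw [← List.cons_append]
        exact List.mem_append_left _ h3
      · simp at h4 ⊢
        omega
  obtain ⟨a, x, v, L, h1, h2, h3, h4⟩ := all (n + 1)
  have := h1.nodup.length_le_card
  rw [List.length_map, Fintype.card_fin] at this
  omega

end minimal

def BikeEvent {n m : ℕ} (Φ : Fin m → Lit2 n × Lit2 n) (k : ℕ) (w : Fin k → Lit2 n)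
    (u v : Lit2 n) (I : Fin (k + 1) → Fin m) : Prop :=
  ∀ i : Fin (k + 1),
    Φ (I i) = (lneg (Fin.cons (α := fun _ => Lit2 n) u w i), Fin.snoc (α := fun _ => Lit2 n) w v i) ∨
    Φ (I i) = (Fin.snoc (α := fun _ => Lit2 n) w v i, lneg (Fin.cons (α := fun _ => Lit2 n) u w i))

lemma exists_bicycle {n m : ℕ} {Φ : Fin m → Lit2 n × Lit2 n} (h : ¬ Sat2 Φ) :
    ∃ k, k < m ∧ ∃ (w : Fin k → Lit2 n) (s t : Fin k) (b : Bool) (I : Fin (k + 1) → Fin m),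
      Function.Injective I ∧ BikeEvent Φ k w ((w s).1, b) (lneg (w t)) I := by
  obtain ⟨J, hJ, hmin⟩ := exists_min_unsat h
  obtain ⟨a, x, v, u, L, h1, h2, h3, h4, z, hz, hzu⟩ := exists_bicycle_aux hJ hmin
  obtain ⟨k, w, w0, wk, wA, wi, wm⟩ := h1.toFun x L rfl
  obtain ⟨t, ht, htv⟩ := (wm _).1 h3
  obtain ⟨s, hs, rfl⟩ := (wm _).1 hz
  have hv : v = lneg (w t) := by rw [htv, lneg_lneg]
  let W : Fin (k + 1) → Lit2 n := fun i => w i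
  let f : ℕ → Lit2 n := fun i => if i = 0 then u else w (i - 1)
  let g : ℕ → Lit2 n := fun i => if i ≤ k then w i else v
  have hf : ∀ i : Fin (k + 2), Fin.cons (α := fun _ => Lit2 n) u W i = f i := by
    intro i
    refine Fin.cases ?_ (fun i => ?_) i
    · simp [f]
    · simp [f, W]
  have hg : ∀ i : Fin (k + 2), Fin.snoc (α := fun _ => Lit2 n) W v i = g i := by
    intro i
    simp [Fin.snoc, g, W]
  have hadj : ∀ i : Fin (k + 2), AdjJ Φ J (f i) (g i) := by
    rintro ⟨i, hi⟩
    by_cases h0 : i = 0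
    · subst h0
      simpa [f, g, w0] using h4
    · by_cases hk : i ≤ k
      · have := wA (i - 1) (by omega)
        rw [Nat.sub_add_cancel (by omega)] at this
        simpa [f, g, h0, hk] using this
      · have : i - 1 = k := by omega
        simpa [f, g, h0, hk, this, wk] using h2
  choose I hIJ hI using hadj
  have hlt : ∀ i i' : Fin (k + 2), i < i' → I i ≠ I i' := by
    rintro ⟨i, hi⟩ ⟨i', hi'⟩ hii he
    have hii : i < i' := hii
    have e1 := hI ⟨i, hi⟩
    have e2 := hI ⟨i', hi'⟩
    rw [he] at e1
    have gi : g i = w i := by simp [g, show i ≤ k by omega]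
    have fi' : f i' = w (i' - 1) := by simp [f, show i' ≠ 0 by omega]
    have fin_inj : ∀ x y : Lit2 n, lneg x = lneg y → x = y := by
      intro x y hxy
      rw [← lneg_lneg x, hxy, lneg_lneg]
    have c1 : f i = f i' → g i = g i' → False := by
      intro hff hgg
      by_cases hk : i' ≤ k
      · have : g i' = w i' := by simp [g, hk]
        rw [gi, this] at hgg
        have := wi i (by omega) i' (by omega) (by rw [hgg])
        omega
      · have h' : g i' = lneg (w t) := by simp [g, hk, hv]
        rw [gi, h'] at hgg
        have := wi i (by omega) t ht (by rw [hgg, lneg_fst])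
        subst this
        exact lneg_ne _ hgg.symm
    have c2 : g i = lneg (f i') → False := by
      intro hgf
      rw [gi, fi'] at hgf
      have := wi i (by omega) (i' - 1) (by omega) (by rw [hgf, lneg_fst])
      rw [← this] at hgf
      exact lneg_ne _ hgf.symm
    simp only at e1 e2
    rcases e1 with e1 | e1 <;> rcases e2 with e2 | e2 <;> rw [e1] at e2 <;>
      simp only [Prod.mk.injEq] at e2
    · exact c1 (fin_inj _ _ e2.1) e2.2
    · exact c2 e2.2
    · exact c2 e2.1
    · exact c1 (fin_inj _ _ e2.2) e2.1
  have hinj : Function.Injective I := by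
    intro i i' he
    rcases lt_trichotomy i i' with h | h | h
    · exact absurd he (hlt _ _ h)
    · exact h
    · exact absurd he.symm (hlt _ _ h)
  refine ⟨k + 1, ?_, W, ⟨s, by omega⟩, ⟨t, by omega⟩, u.2, I, hinj, ?_⟩
  · have := Fintype.card_le_of_injective I hinj
    simp at this
    omega
  · intro i
    have hu : (((W ⟨s, by omega⟩).1, u.2) : Lit2 n) = u := by
      simp only [W]
      rw [hzu]
    have hv' : lneg (W ⟨t, by omega⟩) = v := by rw [hv]
    rw [hu, hv', hf, hg]
    exact hI i

lemma sum_pi_event {α : Type*} [Fintype α] (q : α → ℝ) (hq : ∑ c, q c = 1) {r m : ℕ}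
    (I : Fin r → Fin m) (hI : Function.Injective I) (A : Fin r → α → Prop) :
    (∑ Φ : Fin m → α, if ∀ i, A i (Φ (I i)) then ∏ j, q (Φ j) else 0) =
      ∏ i, ∑ c, if A i c then q c else 0 := by
  have h1 : ∀ Φ : Fin m → α, (if ∀ i, A i (Φ (I i)) then ∏ j, q (Φ j) else 0) =
      ∏ j, (if ∀ i, I i = j → A i (Φ j) then q (Φ j) else 0) := by
    intro Φ
    by_cases h : ∀ i, A i (Φ (I i))
    · rw [if_pos h]
      refine Finset.prod_congr rfl fun j _ => ?_
      rw [if_pos]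
      rintro i rfl
      exact h i
    · rw [if_neg h]
      push Not at h
      obtain ⟨i, hi⟩ := h
      symm
      refine Finset.prod_eq_zero (Finset.mem_univ (I i)) ?_
      rw [if_neg]
      intro h
      exact hi (h i rfl)
  rw [Finset.sum_congr rfl fun Φ _ => h1 Φ]
  have h2 := Finset.prod_univ_sum (fun _ : Fin m => (Finset.univ : Finset α))
    (fun j c => if ∀ i, I i = j → A i c then q c else 0)
  rw [Fintype.piFinset_univ] at h2
  rw [← h2]
  symm
  apply Fintype.prod_of_injective I hI
  · intro j hj
    rw [← hq]
    refine Finset.sum_congr rfl fun c _ => ?_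
    rw [if_pos]
    intro i hi
    exact absurd ⟨i, hi⟩ hj
  · intro i
    refine Finset.sum_congr rfl fun c _ => ?_
    have : (∀ i', I i' = I i → A i' c) ↔ A i c := by
      constructor
      · intro h
        exact h i rfl
      · intro h i' hi'
        rw [hI hi']
        exact h
    simp only [this]

section prob
variable {n : ℕ} {p : ℕ → ℝ}

lemma clauseProb2_sum (h1 : ∑ i ∈ Finset.range n, p i = 1)
    (hS : ∑ i ∈ Finset.range n, p i ^ 2 < 1) :
    ∑ c : Lit2 n × Lit2 n, clauseProb2 n p c = 1 := by
  set S := ∑ i ∈ Finset.range n, p i ^ 2 with hSd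
  have e1 : ∑ i : Fin n, p i = 1 := by rw [← h1, Finset.sum_range]
  have e2 : ∑ i : Fin n, p i ^ 2 = S := by rw [hSd, Finset.sum_range]
  have e3 : ∀ i j : Fin n, (if i ≠ j then (1 - S)⁻¹ / 4 * p i * p j else 0) =
      (1 - S)⁻¹ / 4 * (p i * p j - if i = j then p i ^ 2 else 0) := by
    intro i j
    by_cases h : i = j
    · subst h
      simp
      right
      ring
    · simp [h]
      ring
  have e4 : ∑ i : Fin n, ∑ j : Fin n, (if i ≠ j then (1 - S)⁻¹ / 4 * p i * p j else 0) =
      (1 - S)⁻¹ / 4 * (1 - S) := by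
    simp_rw [e3, ← Finset.mul_sum, Finset.sum_sub_distrib, ← Finset.mul_sum, e1]
    simp [e1, e2]
  simp only [Fintype.sum_prod_type, clauseProb2, ← hSd]
  simp only [Finset.sum_const, Finset.card_univ, Fintype.card_bool, nsmul_eq_mul,
    ← Finset.mul_sum]
  rw [e4]
  have : 1 - S ≠ 0 := by linarith
  field_simp
  norm_num

lemma clauseProb2_bounds (hp : ∀ i < n, 0 < p i) (hS : ∑ i ∈ Finset.range n, p i ^ 2 < 1)
    (c : Lit2 n × Lit2 n) : 0 ≤ clauseProb2 n p c ∧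
      clauseProb2 n p c ≤ Cconst n p / 4 * p c.1.1 * p c.2.1 := by
  have hC : 0 ≤ Cconst n p := by
    unfold Cconst
    exact inv_nonneg.2 (by linarith)
  have h1 := hp c.1.1 c.1.1.2
  have h2 := hp c.2.1 c.2.1.2
  unfold clauseProb2
  split_ifs
  · exact ⟨by change 0 ≤ Cconst n p / 4 * _ * _; positivity, le_rfl⟩
  · exact ⟨le_rfl, by positivity⟩

lemma bike_term (hp : ∀ i < n, 0 < p i) (hS : ∑ i ∈ Finset.range n, p i ^ 2 < 1)
    (h1 : ∑ i ∈ Finset.range n, p i = 1) (hmax : ∀ i < n, p i ≤ p 0) {m : ℕ}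
    (k : ℕ) (w : Fin k → Lit2 n) (u v : Lit2 n) (I : Fin (k + 1) → Fin m) :
    (∑ Φ : Fin m → Lit2 n × Lit2 n,
      if Function.Injective I ∧ BikeEvent Φ k w u v I then formulaProb2 n m p Φ else 0) ≤
      (Cconst n p / 2) ^ (k + 1) * p 0 ^ 2 * ∏ i, p (w i).1 ^ 2 := by
  have hC : 0 ≤ Cconst n p := by
    unfold Cconst
    exact inv_nonneg.2 (by linarith)
  by_cases hI : Function.Injective I
  swap
  · simp only [hI, false_and, if_false, Finset.sum_const_zero]
    positivity
  simp only [hI, true_and]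
  set src : Fin (k + 1) → Lit2 n := Fin.cons (α := fun _ => Lit2 n) u w with hsrc
  set tgt : Fin (k + 1) → Lit2 n := Fin.snoc (α := fun _ => Lit2 n) w v with htgt
  have hpl : ∀ l : Lit2 n, 0 < p l.1 := fun l => hp _ l.1.2
  have e := sum_pi_event (clauseProb2 n p) (clauseProb2_sum h1 hS) I hI
    (fun i c => c = (lneg (src i), tgt i) ∨ c = (tgt i, lneg (src i)))
  have e' : (∑ Φ : Fin m → Lit2 n × Lit2 n,
      if BikeEvent Φ k w u v I then formulaProb2 n m p Φ else 0) =
      ∏ i, ∑ c, if c = (lneg (src i), tgt i) ∨ c = (tgt i, lneg (src i)) then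
        clauseProb2 n p c else 0 := by
    refine Eq.trans ?_ (e.trans ?_)
    · refine Finset.sum_congr rfl fun Φ _ => ?_
      unfold BikeEvent formulaProb2
      congr
    · refine Finset.prod_congr rfl fun i _ => Finset.sum_congr rfl fun c _ => ?_
      congr
  rw [e']
  have step : ∀ i, (∑ c, if c = (lneg (src i), tgt i) ∨ c = (tgt i, lneg (src i)) then
      clauseProb2 n p c else 0) ≤ Cconst n p / 2 * (p (src i).1 * p (tgt i).1) := by
    intro i
    calc _ ≤ ∑ c, ((if c = (lneg (src i), tgt i) then clauseProb2 n p c else 0) +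
          (if c = (tgt i, lneg (src i)) then clauseProb2 n p c else 0)) := by
          refine Finset.sum_le_sum fun c _ => ?_
          have := (clauseProb2_bounds hp hS c).1
          generalize (lneg (src i), tgt i) = X
          generalize (tgt i, lneg (src i)) = Y
          by_cases a : c = X
          · rw [if_pos (Or.inl a), if_pos a]
            split_ifs <;> linarith
          · by_cases b : c = Y
            · rw [if_pos (Or.inr b), if_neg a, if_pos b]
              linarith
            · rw [if_neg (by tauto), if_neg a, if_neg b]
              linarith
      _ = clauseProb2 n p (lneg (src i), tgt i) + clauseProb2 n p (tgt i, lneg (src i)) := by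
          rw [Finset.sum_add_distrib]
          simp
      _ ≤ Cconst n p / 4 * p (src i).1 * p (tgt i).1 +
          Cconst n p / 4 * p (tgt i).1 * p (src i).1 :=
          add_le_add (clauseProb2_bounds hp hS (lneg (src i), tgt i)).2
            (clauseProb2_bounds hp hS (tgt i, lneg (src i))).2
      _ = _ := by ring
  calc _ ≤ ∏ i, (Cconst n p / 2 * (p (src i).1 * p (tgt i).1)) := by
        refine Finset.prod_le_prod (fun i _ => ?_) (fun i _ => step i)
        refine Finset.sum_nonneg fun c _ => ?_
        split_ifs
        · exact (clauseProb2_bounds hp hS c).1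
        · exact le_rfl
    _ = (Cconst n p / 2) ^ (k + 1) * ((p u.1 * ∏ i, p (w i).1) * ((∏ i, p (w i).1) * p v.1)) := by
        rw [Finset.prod_mul_distrib, Finset.prod_mul_distrib, Finset.prod_const,
          Finset.card_univ, Fintype.card_fin, Fin.prod_univ_succ (fun i => p (src i).1),
          Fin.prod_univ_castSucc (fun i => p (tgt i).1)]
        simp [hsrc, htgt]
    _ = (Cconst n p / 2) ^ (k + 1) * (p u.1 * p v.1) * ∏ i, p (w i).1 ^ 2 := by
        rw [Finset.prod_pow]
        ring
    _ ≤ _ := by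
        have : p u.1 * p v.1 ≤ p 0 ^ 2 := by
          rw [sq]
          exact mul_le_mul (hmax _ u.1.2) (hmax _ v.1.2) (hpl v).le
            ((hpl u).le.trans (hmax _ u.1.2))
        gcongr

lemma unsat_bound (hp : ∀ i < n, 0 < p i) (hS : ∑ i ∈ Finset.range n, p i ^ 2 < 1)
    (h1 : ∑ i ∈ Finset.range n, p i = 1) (hmax : ∀ i < n, p i ≤ p 0) (m : ℕ) :
    probUnsat2 n m p ≤ ∑ k ∈ Finset.range m, (m * Cconst n p * p 0 ^ 2) *
      ((k : ℝ) ^ 2 * (m * Cconst n p * ∑ i ∈ Finset.range n, p i ^ 2) ^ k) := by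
  have hF : ∀ Φ : Fin m → Lit2 n × Lit2 n, 0 ≤ formulaProb2 n m p Φ := fun Φ =>
    Finset.prod_nonneg fun j _ => (clauseProb2_bounds hp hS _).1
  have hle : probUnsat2 n m p ≤ ∑ Φ : Fin m → Lit2 n × Lit2 n, ∑ k ∈ Finset.range m,
      ∑ x : (Fin k → Lit2 n) × Fin k × Fin k × Bool × (Fin (k + 1) → Fin m),
        if Function.Injective x.2.2.2.2 ∧
          BikeEvent Φ k x.1 ((x.1 x.2.1).1, x.2.2.2.1) (lneg (x.1 x.2.2.1)) x.2.2.2.2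
        then formulaProb2 n m p Φ else 0 := by
    unfold probUnsat2
    refine Finset.sum_le_sum fun Φ _ => ?_
    have hnn : ∀ k, ∀ x : (Fin k → Lit2 n) × Fin k × Fin k × Bool × (Fin (k + 1) → Fin m),
        0 ≤ if Function.Injective x.2.2.2.2 ∧
          BikeEvent Φ k x.1 ((x.1 x.2.1).1, x.2.2.2.1) (lneg (x.1 x.2.2.1)) x.2.2.2.2
        then formulaProb2 n m p Φ else 0 := by
      intro k x
      split_ifs
      · exact hF Φ
      · exact le_rfl
    by_cases hs : Sat2 Φ
    · rw [if_neg (not_not.2 hs)]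
      exact Finset.sum_nonneg fun k _ => Finset.sum_nonneg fun x _ => hnn k x
    · rw [if_pos hs]
      obtain ⟨k, hk, w, s, t, b, I, hI, hB⟩ := exists_bicycle hs
      refine le_trans ?_ (Finset.single_le_sum (fun k _ => Finset.sum_nonneg fun x _ => hnn k x)
        (Finset.mem_range.2 hk))
      refine le_trans ?_ (Finset.single_le_sum (fun x _ => hnn k x)
        (Finset.mem_univ (w, s, t, b, I)))
      rw [if_pos ⟨hI, hB⟩]
  refine hle.trans ?_
  rw [Finset.sum_comm]
  refine Finset.sum_le_sum fun k _ => ?_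
  rw [Finset.sum_comm]
  have hw : ∑ w : Fin k → Lit2 n, ∏ i, p (w i).1 ^ 2 =
      (2 * ∑ i ∈ Finset.range n, p i ^ 2) ^ k := by
    rw [← Fintype.sum_pow (fun l : Lit2 n => p l.1 ^ 2) k, Finset.sum_range]
    congr 1
    rw [Fintype.sum_prod_type]
    simp [Finset.mul_sum]
  calc _ ≤ ∑ x : (Fin k → Lit2 n) × Fin k × Fin k × Bool × (Fin (k + 1) → Fin m),
        (Cconst n p / 2) ^ (k + 1) * p 0 ^ 2 * ∏ i, p (x.1 i).1 ^ 2 :=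
        Finset.sum_le_sum fun x _ => bike_term hp hS h1 hmax k _ _ _ _
    _ = (Cconst n p / 2) ^ (k + 1) * p 0 ^ 2 * (2 * ∑ i ∈ Finset.range n, p i ^ 2) ^ k *
        (k * k * 2 * m ^ (k + 1)) := by
        rw [Fintype.sum_prod_type]
        simp only [Finset.sum_const, Finset.card_univ, nsmul_eq_mul, Fintype.card_prod,
          Fintype.card_fin, Fintype.card_bool, Fintype.card_pi, Finset.prod_const]
        rw [← Finset.mul_sum, ← Finset.mul_sum, hw]
        push_cast
        ring
    _ ≤ _ := by
        apply le_of_eq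
        rw [div_pow, mul_pow, mul_pow, mul_pow, pow_succ (2 : ℝ)]
        have : (2 : ℝ) ^ k ≠ 0 := by positivity
        field_simp
        ring

lemma sat_add_unsat (hS : ∑ i ∈ Finset.range n, p i ^ 2 < 1)
    (h1 : ∑ i ∈ Finset.range n, p i = 1) (m : ℕ) :
    probSat2 n m p + probUnsat2 n m p = 1 := by
  unfold probSat2 probUnsat2
  rw [← Finset.sum_add_distrib]
  have e := sum_pi_event (r := 0) (m := m) (clauseProb2 n p) (clauseProb2_sum h1 hS)
    Fin.elim0 (fun i => i.elim0) (fun _ _ => True)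
  simp only [implies_true, if_true, Finset.univ_eq_empty, Finset.prod_empty] at e
  rw [← e]
  refine Finset.sum_congr rfl fun Φ _ => ?_
  by_cases h : Sat2 Φ <;> simp [h, formulaProb2]

lemma unsat_nonneg (hp : ∀ i < n, 0 < p i) (hS : ∑ i ∈ Finset.range n, p i ^ 2 < 1) (m : ℕ) :
    0 ≤ probUnsat2 n m p := by
  refine Finset.sum_nonneg fun Φ _ => ?_
  split_ifs
  · exact le_rfl
  · exact Finset.prod_nonneg fun j _ => (clauseProb2_bounds hp hS _).1

end prob

/-- If `p₁² = o(∑ pᵢ²)` and `m < (1-ε)·(∑ pᵢ²)⁻¹`, then a non-uniform random 2-SAT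
formula is satisfiable with probability `1 - o(1)`. -/
theorem nonuniform_2SAT_satisfiable_below_threshold
    (p : ℕ → ℕ → ℝ) (hp : ProbEnsemble p)
    (ho : (fun n => p n 0 ^ 2) =o[atTop] fun n => ∑ i ∈ Finset.range n, p n i ^ 2)
    (ε : ℝ) (hε : 0 < ε) (m : ℕ → ℕ)
    (hm : ∀ᶠ n in atTop, (m n : ℝ) < (1 - ε) * (∑ i ∈ Finset.range n, p n i ^ 2)⁻¹) :
    Tendsto (fun n => probSat2 n (m n) (p n)) atTop (nhds 1) := by
  set S : ℕ → ℝ := fun n => ∑ i ∈ Finset.range n, p n i ^ 2 with hSd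
  have hSpos : ∀ n, 1 ≤ n → 0 < S n := by
    intro n hn
    refine Finset.sum_pos (fun i hi => ?_) ⟨0, Finset.mem_range.2 (by omega)⟩
    have := (hp n hn).2.2 i (Finset.mem_range.1 hi)
    positivity
  have hmax : ∀ n, 1 ≤ n → ∀ i < n, p n i ≤ p n 0 := fun n hn i hi =>
    (hp n hn).2.1 0 i (Nat.zero_le _) hi
  have hSle : ∀ n, 1 ≤ n → S n ≤ p n 0 := by
    intro n hn
    calc S n ≤ ∑ i ∈ Finset.range n, p n 0 * p n i := by
          refine Finset.sum_le_sum fun i hi => ?_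
          have hi := Finset.mem_range.1 hi
          rw [sq]
          exact mul_le_mul_of_nonneg_right (hmax n hn i hi) ((hp n hn).2.2 i hi).le
      _ = p n 0 := by rw [← Finset.mul_sum, (hp n hn).1, mul_one]
  have hratio : Tendsto (fun n => p n 0 ^ 2 / S n) atTop (nhds 0) := ho.tendsto_div_nhds_zero
  have hp0 : Tendsto (fun n => p n 0) atTop (nhds 0) := by
    refine squeeze_zero' ?_ ?_ hratio
    · filter_upwards [eventually_ge_atTop 1] with n hn
      exact ((hp n hn).2.2 0 (by omega)).le
    · filter_upwards [eventually_ge_atTop 1] with n hn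
      have h0 := (hp n hn).2.2 0 (by omega)
      rw [le_div_iff₀ (hSpos n hn), sq]
      exact mul_le_mul_of_nonneg_left (hSle n hn) h0.le
  have hS0 : Tendsto S atTop (nhds 0) := by
    refine squeeze_zero' ?_ ?_ hp0
    · filter_upwards [eventually_ge_atTop 1] with n hn using (hSpos n hn).le
    · filter_upwards [eventually_ge_atTop 1] with n hn using hSle n hn
  by_cases hε1 : 1 ≤ ε
  · exfalso
    obtain ⟨n, h1, h2⟩ := (hm.and (eventually_ge_atTop 1)).exists
    have h3 := hSpos n h2
    have h4 : (1 - ε) * (S n)⁻¹ ≤ 0 :=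
      mul_nonpos_of_nonpos_of_nonneg (by linarith) (inv_nonneg.2 h3.le)
    have h5 : (0 : ℝ) ≤ m n := Nat.cast_nonneg _
    linarith
  push Not at hε1
  set r : ℝ := 1 - ε / 2 with hr
  have hr0 : 0 ≤ r := by rw [hr]; linarith
  have hr1 : r < 1 := by rw [hr]; linarith
  have hsum : Summable fun k : ℕ => (k : ℝ) ^ 2 * r ^ k :=
    summable_pow_mul_geometric_of_norm_lt_one 2 (by rw [Real.norm_of_nonneg hr0]; exact hr1)
  set K : ℝ := ∑' k : ℕ, (k : ℝ) ^ 2 * r ^ k with hK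
  have hsmall : ∀ᶠ n in atTop, S n < ε / 2 := hS0.eventually_lt_const (by linarith)
  have hun : Tendsto (fun n => probUnsat2 n (m n) (p n)) atTop (nhds 0) := by
    have hlim : Tendsto (fun n => 2 * (p n 0 ^ 2 / S n) * K) atTop (nhds 0) := by
      have := (hratio.const_mul 2).mul_const K
      simpa using this
    refine squeeze_zero' ?_ ?_ hlim
    · filter_upwards [eventually_ge_atTop 1, hsmall] with n hn hs
      exact unsat_nonneg (hp n hn).2.2 (by change S n < 1; linarith) _
    · filter_upwards [eventually_ge_atTop 1, hsmall, hm] with n hn hs hmn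
      have hSp := hSpos n hn
      have hS1 : S n < 1 := by linarith
      have hC : Cconst n (p n) = (1 - S n)⁻¹ := rfl
      have hCpos : 0 < Cconst n (p n) := by rw [hC]; exact inv_pos.2 (by linarith)
      have hC2 : Cconst n (p n) ≤ 2 := by
        rw [hC]
        exact inv_le_of_inv_le₀ (by norm_num) (by linarith)
      have hmS : (m n : ℝ) * S n ≤ 1 - ε := by
        have := mul_le_mul_of_nonneg_right hmn.le hSp.le
        rwa [mul_assoc, inv_mul_cancel₀ hSp.ne', mul_one] at this
      have hmSle : (m n : ℝ) ≤ 1 / S n := by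
        rw [le_div_iff₀ hSp]
        linarith
      have hrr : m n * Cconst n (p n) * S n ≤ r := by
        have : m n * Cconst n (p n) * S n = (m n * S n) / (1 - S n) := by
          rw [hC]
          ring
        rw [this, div_le_iff₀ (by linarith)]
        nlinarith
      have hpos : 0 ≤ m n * Cconst n (p n) * S n := by positivity
      refine (unsat_bound (hp n hn).2.2 hS1 (hp n hn).1 (hmax n hn) (m n)).trans ?_
      rw [← Finset.mul_sum]
      have hb : ∑ k ∈ Finset.range (m n), (k : ℝ) ^ 2 * (m n * Cconst n (p n) * S n) ^ k ≤ K := by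
        calc _ ≤ ∑ k ∈ Finset.range (m n), (k : ℝ) ^ 2 * r ^ k := by
              refine Finset.sum_le_sum fun k _ => ?_
              gcongr
          _ ≤ K := hsum.sum_le_tsum _ (fun k _ => by positivity)
      have ha : m n * Cconst n (p n) * p n 0 ^ 2 ≤ 2 * (p n 0 ^ 2 / S n) := by
        calc _ ≤ 1 / S n * 2 * p n 0 ^ 2 := by gcongr
          _ = _ := by ring
      exact mul_le_mul ha hb (Finset.sum_nonneg fun k _ => by positivity) (by positivity)
  have hfin : Tendsto (fun n => 1 - probUnsat2 n (m n) (p n)) atTop (nhds 1) := by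
    simpa using hun.const_sub 1
  refine hfin.congr' ?_
  filter_upwards [eventually_ge_atTop 1, hsmall] with n hn hs
  have := sat_add_unsat (p := p n) (n := n) (by change S n < 1; linarith) (hp n hn).1 (m n)
  linarith
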